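/- arXiv:2310.13750 — 3 statements merged into one kernel-verified Lean document; each statement's English description precedes it below -/
import Mathlib

section
/- Let 0 < γ < ∞, 0 < q < ∞ and 1 < r ≤ ∞, and assume γ = max{3/(2q) − 1/(2r′), 2/q − 1/r′} and γ > 2/q − 1/2. If there exists C > 0 such that ‖R*_γF‖_{L^q(ℝ²)} ≤ C · ‖F‖_{L^r(S¹)} for all measurable F : ℝ → ℂ, then q ≥ r (i.e. 1/q ≤ 1/r). -/
open MeasureTheory Real Set Filter
open scoped ENNReal

noncomputable section

/-- Fourier extension operator of the unit circle,
`(R*F)(x,y) = (1/(2π)) ∫_0^{2π} F(φ) exp(i(x cos φ + y sin φ)) dφ`. -/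
def Rext (F : ℝ → ℂ) (x y : ℝ) : ℂ :=
  Complex.ofReal (1 / (2 * π)) *
    ∫ φ in (0:ℝ)..(2 * π),
      F φ * Complex.exp (Complex.I * Complex.ofReal (x * Real.cos φ + y * Real.sin φ))

/-- Weighted extension operator with product weight `(1+|x|)^{-α}(1+|y|)^{-β}`. -/
def Rab (α β : ℝ) (F : ℝ → ℂ) (x y : ℝ) : ℂ :=
  Rext F x y * Complex.ofReal ((1 + |x|) ^ (-α) * (1 + |y|) ^ (-β))

/-- Weighted extension operator with weight `(1+|x|+|y|)^{-γ}`. -/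
def Rgamma (γ : ℝ) (F : ℝ → ℂ) (x y : ℝ) : ℂ :=
  Rext F x y * Complex.ofReal ((1 + |x| + |y|) ^ (-γ))

/-- `L^r` norm on the circle, parametrized by `[0, 2π]`. -/
def circleLp (r : ℝ≥0∞) (F : ℝ → ℂ) : ℝ≥0∞ :=
  eLpNorm F r (volume.restrict (Ioc (0:ℝ) (2 * π)))

/-- `L^q` quasinorm on the plane. -/
def planeLp (q : ℝ≥0∞) (g : ℝ × ℝ → ℂ) : ℝ≥0∞ :=
  eLpNorm g q (volume : Measure (ℝ × ℝ))

/-- Weak `L^q` quasinorm on the line. -/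
def wline (q : ℝ) (g : ℝ → ℂ) : ℝ≥0∞ :=
  ⨆ (t : ℝ) (_ : 0 < t), ENNReal.ofReal t * (volume {x : ℝ | t < ‖g x‖}) ^ (1 / q)

/-- Weak `L^q` quasinorm on the line, for `ℝ≥0∞`-valued functions. -/
def wlineE (q : ℝ) (g : ℝ → ℝ≥0∞) : ℝ≥0∞ :=
  ⨆ (t : ℝ) (_ : 0 < t), ENNReal.ofReal t * (volume {x : ℝ | ENNReal.ofReal t < g x}) ^ (1 / q)

/-- Mixed weak quasinorm `L^{q,∞}_x(L^{q,∞}_y)`. -/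
def mixedXY (q : ℝ) (g : ℝ × ℝ → ℂ) : ℝ≥0∞ :=
  wlineE q fun x => wline q fun y => g (x, y)

/-- Mixed weak quasinorm `L^{q,∞}_y(L^{q,∞}_x)`. -/
def mixedYX (q : ℝ) (g : ℝ × ℝ → ℂ) : ℝ≥0∞ :=
  wlineE q fun y => wline q fun x => g (x, y)

/-- Weak `L^q` quasinorm on the plane. -/
def wplane (q : ℝ) (g : ℝ × ℝ → ℂ) : ℝ≥0∞ :=
  ⨆ (t : ℝ) (_ : 0 < t), ENNReal.ofReal t * (volume {p : ℝ × ℝ | t < ‖g p‖}) ^ (1 / q)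

/-- Lorentz `L^{r,1}` norm on the circle. -/
def lorentz1 (r : ℝ) (F : ℝ → ℂ) : ℝ≥0∞ :=
  ∫⁻ t in Ioi (0:ℝ), (volume {φ ∈ Icc (0:ℝ) (2 * π) | t < ‖F φ‖}) ^ (1 / r)

/-- Weak `L^r` quasinorm on the circle. -/
def wcircle (r : ℝ) (F : ℝ → ℂ) : ℝ≥0∞ :=
  ⨆ (t : ℝ) (_ : 0 < t), ENNReal.ofReal t * (volume {φ ∈ Icc (0:ℝ) (2 * π) | t < ‖F φ‖}) ^ (1 / r)

/-- bump -/
def bmp (s d : ℝ) : ℝ → ℂ := (Ioc d (2*d)).indicator (fun _ => ((d ^ (-s) : ℝ) : ℂ))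

lemma bmp_meas (s d : ℝ) : Measurable (bmp s d) :=
  measurable_const.indicator measurableSet_Ioc

lemma Rext_meas (F : ℝ → ℂ) (hF : Measurable F) : Measurable (fun p : ℝ × ℝ => Rext F p.1 p.2) := by
  unfold Rext
  apply Measurable.const_mul
  simp_rw [intervalIntegral.integral_of_le (by positivity : (0:ℝ) ≤ 2 * π)]
  have : StronglyMeasurable (fun z : (ℝ × ℝ) × ℝ => F z.2 * Complex.exp (Complex.I *
      Complex.ofReal (z.1.1 * Real.cos z.2 + z.1.2 * Real.sin z.2))) := by
    apply Measurable.stronglyMeasurable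
    fun_prop
  exact (this.integral_prod_right' (ν := volume.restrict (Ioc 0 (2*π)))).measurable

lemma Rgamma_meas (γ : ℝ) (F : ℝ → ℂ) (hF : Measurable F) :
    Measurable (fun p : ℝ × ℝ => Rgamma γ F p.1 p.2) := by
  unfold Rgamma
  exact (Rext_meas F hF).mul (by fun_prop)

lemma bmp_int (s d x y : ℝ) (hd : 0 < d) (hd2 : d ≤ 1/2) :
    ∫ φ in (0:ℝ)..(2 * π), bmp s d φ * Complex.exp (Complex.I * Complex.ofReal (x * Real.cos φ + y * Real.sin φ))
    = ((d ^ (-s) : ℝ) : ℂ) * ∫ φ in d..(2*d), Complex.exp (Complex.I * Complex.ofReal (x * Real.cos φ + y * Real.sin φ)) := by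
  have hpi := Real.pi_gt_three
  rw [intervalIntegral.integral_of_le (by positivity : (0:ℝ) ≤ 2 * π),
    intervalIntegral.integral_of_le (by linarith : d ≤ 2 * d), ← integral_const_mul]
  have : ∀ φ : ℝ, bmp s d φ * Complex.exp (Complex.I * Complex.ofReal (x * Real.cos φ + y * Real.sin φ))
     = (Ioc d (2*d)).indicator (fun φ => ((d ^ (-s) : ℝ) : ℂ) * Complex.exp (Complex.I * Complex.ofReal (x * Real.cos φ + y * Real.sin φ))) φ := by
    intro φ
    unfold bmp
    by_cases h : φ ∈ Ioc d (2*d) <;> simp [h]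
  simp_rw [this]
  rw [setIntegral_indicator measurableSet_Ioc]
  congr 2
  rw [inter_eq_right]
  apply Ioc_subset_Ioc <;> linarith

lemma cos_lb (t : ℝ) (h : |t| ≤ 1) : 1/2 ≤ Real.cos t := by
  have := Real.one_sub_sq_div_two_le_cos (x := t)
  have h2 : t^2 ≤ 1 := by rw [← sq_abs]; nlinarith [abs_nonneg t]
  linarith

lemma osc_lb (d x y : ℝ) (hd : 0 < d) (h : (|x| + |y|) * d ≤ 1) :
    d / 2 ≤ ‖∫ φ in d..(2*d), Complex.exp (Complex.I * Complex.ofReal (x * Real.cos φ + y * Real.sin φ))‖ := by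
  set θ : ℝ → ℝ := fun φ => x * Real.cos φ + y * Real.sin φ with hθ
  have hc : Continuous θ := by fun_prop
  have e1 : ‖∫ φ in d..(2*d), Complex.exp (Complex.I * Complex.ofReal (θ φ))‖
     = ‖∫ φ in d..(2*d), Complex.exp (Complex.I * Complex.ofReal (θ φ - θ d))‖ := by
    have : ∀ φ, Complex.exp (Complex.I * Complex.ofReal (θ φ - θ d)) =
       Complex.exp ((-θ d : ℝ) * Complex.I) * Complex.exp (Complex.I * Complex.ofReal (θ φ)) := by
      intro φ
      rw [← Complex.exp_add]; congr 1; push_cast; ring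
    simp_rw [this]
    rw [intervalIntegral.integral_const_mul, norm_mul, Complex.norm_exp_ofReal_mul_I, one_mul]
  change d/2 ≤ ‖∫ φ in d..(2*d), Complex.exp (Complex.I * Complex.ofReal (θ φ))‖
  rw [e1]
  refine le_trans ?_ (Complex.re_le_norm _)
  have hi : IntervalIntegrable (fun φ => Complex.exp (Complex.I * Complex.ofReal (θ φ - θ d))) volume d (2*d) :=
    Continuous.intervalIntegrable (by fun_prop) _ _
  have e2 := Complex.reCLM.intervalIntegral_comp_comm hi
  simp only [Complex.reCLM_apply] at e2
  rw [← e2]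
  have e3 : ∫ φ in d..(2*d), (1/2:ℝ) = d/2 := by simp; ring
  rw [← e3]
  apply intervalIntegral.integral_mono_on (by linarith) (by simp) (Continuous.intervalIntegrable (by fun_prop) _ _)
  intro φ hφ
  rw [mul_comm, Complex.exp_ofReal_mul_I_re]
  apply cos_lb
  refine le_trans ?_ h
  have hd' : |φ - d| ≤ d := by rw [abs_le]; constructor <;> linarith [hφ.1, hφ.2]
  have h1 : |Real.cos φ - Real.cos d| ≤ d := (Real.abs_cos_sub_cos_le φ d).trans hd'
  have h2 : |Real.sin φ - Real.sin d| ≤ d := (Real.abs_sin_sub_sin_le φ d).trans hd'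
  calc |θ φ - θ d| = |x * (Real.cos φ - Real.cos d) + y * (Real.sin φ - Real.sin d)| := by
        congr 1; simp only [hθ]; ring
    _ ≤ |x| * |Real.cos φ - Real.cos d| + |y| * |Real.sin φ - Real.sin d| := by
        rw [← abs_mul, ← abs_mul]; exact abs_add_le _ _
    _ ≤ |x| * d + |y| * d := by gcongr
    _ = _ := by ring

/-- region -/
def reg (d : ℝ) : Set (ℝ × ℝ) := Ico (1/(8*d)) (1/(4*d)) ×ˢ Icc 0 (1/(8*d))

lemma reg_meas (d : ℝ) : MeasurableSet (reg d) := measurableSet_Ico.prod measurableSet_Icc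

lemma reg_vol (d : ℝ) (hd : 0 < d) : volume (reg d) = ENNReal.ofReal (d ^ (-2:ℝ) / 64) := by
  unfold reg
  rw [Measure.volume_eq_prod, Measure.prod_prod, Real.volume_Ico, Real.volume_Icc,
    ← ENNReal.ofReal_mul]
  · congr 1
    rw [Real.rpow_neg hd.le, Real.rpow_two]
    field_simp
    norm_num
  · rw [sub_nonneg]; apply one_div_le_one_div_of_le <;> linarith

lemma bmp_lb (γ s q d : ℝ) (hγ : 0 < γ) (hq : 0 < q) (hd : 0 < d) (hd2 : d ≤ 1/2)
    (hs : γ + 1 - s = 2 / q) (p : ℝ × ℝ) (hp : p ∈ reg d) :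
    (1 / (4*π)) * d ^ (2/q) ≤ ‖Rgamma γ (bmp s d) p.1 p.2‖ := by
  obtain ⟨x, y⟩ := p
  obtain ⟨⟨hx1, hx2⟩, hy1, hy2⟩ := hp
  simp only at hx1 hx2 hy1 hy2 ⊢
  have hx0 : 0 ≤ x := le_trans (by positivity) hx1
  have hxy : (|x| + |y|) * d ≤ 3/8 := by
    rw [abs_of_nonneg hx0, abs_of_nonneg hy1]
    have : x + y ≤ 1/(4*d) + 1/(8*d) := by linarith
    calc _ ≤ (1/(4*d) + 1/(8*d)) * d := by gcongr
      _ = 3/8 := by field_simp; norm_num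
  have hw : 1 + |x| + |y| ≤ d⁻¹ := by
    rw [le_inv_comm₀ (by positivity) hd, ← one_div, le_div_iff₀ (by positivity)]
    nlinarith
  have hw2 : d ^ γ ≤ (1 + |x| + |y|) ^ (-γ) := by
    calc d ^ γ = (d⁻¹) ^ (-γ) := by
          rw [Real.inv_rpow hd.le, Real.rpow_neg hd.le, inv_inv]
      _ ≤ _ := Real.rpow_le_rpow_of_nonpos (by positivity) hw (by linarith)
  unfold Rgamma Rext
  rw [bmp_int s d x y hd hd2]
  rw [norm_mul, norm_mul, norm_mul, Complex.norm_real, Complex.norm_real, Complex.norm_real,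
    Real.norm_of_nonneg (by positivity), Real.norm_of_nonneg (by positivity),
    Real.norm_of_nonneg (by positivity)]
  have h := osc_lb d x y hd (by linarith)
  calc (1 / (4*π)) * d ^ (2/q) = 1 / (2*π) * (d ^ (-s) * (d / 2)) * d ^ γ := by
        have : d ^ (2/q) = d ^ (-s) * d * d ^ γ := by
          rw [← hs, ← Real.rpow_add_one hd.ne', ← Real.rpow_add hd]; congr 1; ring
        rw [this]; field_simp; norm_num
    _ ≤ _ := by gcongr

lemma bmp_ii (s d x y : ℝ) : IntervalIntegrable (fun φ => bmp s d φ * Complex.exp (Complex.I * Complex.ofReal (x * Real.cos φ + y * Real.sin φ))) volume 0 (2*π) := by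
  apply IntervalIntegrable.mul_continuousOn
  · rw [intervalIntegrable_iff, uIoc_of_le (by positivity)]
    apply Integrable.indicator _ measurableSet_Ioc
    exact integrable_const _
  · fun_prop

lemma Rgamma_lin (γ s : ℝ) {N : ℕ} (d : Fin N → ℝ) (ε : Fin N → ℂ) (x y : ℝ) :
    Rgamma γ (fun φ => ∑ j, ε j * bmp s (d j) φ) x y = ∑ j, ε j * Rgamma γ (bmp s (d j)) x y := by
  unfold Rgamma Rext
  simp_rw [Finset.sum_mul]
  rw [intervalIntegral.integral_finset_sum]
  · simp_rw [mul_assoc]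
    rw [Finset.sum_mul, Finset.mul_sum]
    refine Finset.sum_congr rfl fun j _ => ?_
    rw [intervalIntegral.integral_const_mul]
    ring
  · intro j _
    simp_rw [mul_assoc]
    exact (bmp_ii s (d j) x y).const_mul _

/-- sign -/
def sg {N : ℕ} (ε : Fin N → ℤˣ) (j : Fin N) : ℂ := ((ε j : ℤ) : ℂ)

lemma sg_norm {N : ℕ} (ε : Fin N → ℤˣ) (j : Fin N) : ‖sg ε j‖ = 1 := by
  unfold sg
  rcases Int.units_eq_one_or (ε j) with h | h <;> simp [h]

lemma signs {N : ℕ} (z : Fin N → ℂ) (q : ℝ) (hq : 0 < q) (j : Fin N) :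
    (Fintype.card (Fin N → ℤˣ) : ℝ≥0∞) * ‖z j‖ₑ ^ q ≤ 2 * ∑ ε : Fin N → ℤˣ, ‖∑ i, sg ε i * z i‖ₑ ^ q := by
  set S : (Fin N → ℤˣ) → ℂ := fun ε => ∑ i, sg ε i * z i with hS
  set e : (Fin N → ℤˣ) ≃ (Fin N → ℤˣ) := Equiv.mulLeft (Pi.mulSingle j (-1)) with he
  have hdiff : ∀ ε, S ε - S (e ε) = 2 * (sg ε j * z j) := by
    intro ε
    simp only [hS]
    rw [← Finset.sum_sub_distrib, Finset.sum_eq_single j]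
    · simp [he, sg]; ring
    · intro i _ hi
      simp [he, sg, Pi.mulSingle_eq_of_ne hi]
    · simp
  have hp : ∀ ε, ‖z j‖ₑ ^ q ≤ ‖S ε‖ₑ ^ q + ‖S (e ε)‖ₑ ^ q := by
    intro ε
    have h1 : 2 * ‖z j‖ ≤ ‖S ε‖ + ‖S (e ε)‖ := by
      have := norm_sub_le (S ε) (S (e ε))
      rw [hdiff, norm_mul, norm_mul, sg_norm] at this
      simpa using this
    rcases le_total ‖S ε‖ ‖S (e ε)‖ with h | h
    · refine le_trans ?_ le_add_self
      apply ENNReal.rpow_le_rpow _ hq.le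
      rw [enorm_le_iff_norm_le]; linarith
    · refine le_trans ?_ le_self_add
      apply ENNReal.rpow_le_rpow _ hq.le
      rw [enorm_le_iff_norm_le]; linarith
  calc (Fintype.card (Fin N → ℤˣ) : ℝ≥0∞) * ‖z j‖ₑ ^ q = ∑ ε : Fin N → ℤˣ, ‖z j‖ₑ ^ q := by
        rw [Finset.sum_const, nsmul_eq_mul]; rfl
    _ ≤ ∑ ε, (‖S ε‖ₑ ^ q + ‖S (e ε)‖ₑ ^ q) := Finset.sum_le_sum fun ε _ => hp ε
    _ = _ := by
        rw [Finset.sum_add_distrib, Equiv.sum_comp e (fun ε => ‖S ε‖ₑ ^ q), two_mul]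

/-- scales -/
def dd (j : ℕ) : ℝ := (1/2)^(j+1)
lemma dd_pos (j : ℕ) : 0 < dd j := by unfold dd; positivity
lemma dd_le (j : ℕ) : dd j ≤ 1/2 := by
  unfold dd; rw [pow_succ]
  have : (1/2:ℝ)^j ≤ 1 := pow_le_one₀ (by norm_num) (by norm_num)
  linarith
lemma dd_lt {i j : ℕ} (h : i < j) : 2 * dd j ≤ dd i := by
  unfold dd
  have : (1/2:ℝ)^j ≤ (1/2)^(i+1) := pow_le_pow_of_le_one (by norm_num) (by norm_num) h
  rw [pow_succ _ j]; linarith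

lemma bmp_disj {i j : ℕ} (h : i ≠ j) (φ : ℝ) (hi : φ ∈ Ioc (dd i) (2 * dd i)) :
    φ ∉ Ioc (dd j) (2 * dd j) := by
  rintro ⟨h1, h2⟩
  rcases lt_or_gt_of_ne h with h | h
  · have := dd_lt h; linarith [hi.1, hi.2]
  · have := dd_lt h; linarith [hi.1, hi.2]

lemma reg_disj {i j : ℕ} (h : i < j) : Disjoint (reg (dd i)) (reg (dd j)) := by
  rw [Set.disjoint_left]
  rintro ⟨x, y⟩ ⟨⟨_, h1⟩, _⟩ ⟨⟨h2, _⟩, _⟩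
  simp only at h1 h2
  have := one_div_le_one_div_of_le (by have := dd_pos j; positivity) (show 8 * dd j ≤ 4 * dd i by linarith [dd_lt h])
  linarith

lemma upper (s ρ : ℝ) (hρ : 0 < ρ) (hs : s = 1/ρ) (N : ℕ) (ε : Fin N → ℤˣ) :
    ∫⁻ φ in Ioc (0:ℝ) (2*π), ‖∑ j : Fin N, sg ε j * bmp s (dd j) φ‖ₑ ^ ρ ≤ N := by
  have h1 : ∀ φ, ‖∑ j : Fin N, sg ε j * bmp s (dd j) φ‖ₑ ^ ρ ≤ ∑ j : Fin N, ‖bmp s (dd j) φ‖ₑ ^ ρ := by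
    intro φ
    by_cases h : ∃ j : Fin N, φ ∈ Ioc (dd j) (2 * dd j)
    · obtain ⟨j, hj⟩ := h
      rw [Finset.sum_eq_single j]
      · rw [enorm_mul]
        have : ‖sg ε j‖ₑ = 1 := by rw [← ofReal_norm, sg_norm]; simp
        rw [this, one_mul]
        exact Finset.single_le_sum (f := fun j : Fin N => ‖bmp s (dd j) φ‖ₑ ^ ρ) (fun _ _ => zero_le) (Finset.mem_univ j)
      · intro i _ hi
        have := bmp_disj (i := j) (j := i) (fun h => hi (Fin.ext h.symm)) φ hj
        simp only [bmp, indicator_of_notMem this, mul_zero]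
      · simp
    · push Not at h
      rw [Finset.sum_eq_zero]
      · simp [hρ]
      · intro i _
        simp only [bmp, indicator_of_notMem (h i), mul_zero]
  have h2 : ∀ j : Fin N, ∫⁻ φ in Ioc (0:ℝ) (2*π), ‖bmp s (dd j) φ‖ₑ ^ ρ ≤ 1 := by
    intro j
    have hd := dd_pos j
    have : ∀ φ, ‖bmp s (dd j) φ‖ₑ ^ ρ = (Ioc (dd j) (2 * dd j)).indicator (fun _ => ENNReal.ofReal ((dd j)⁻¹)) φ := by
      intro φ
      by_cases h : φ ∈ Ioc (dd j) (2 * dd j)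
      · simp only [bmp, indicator_of_mem h]
        rw [← ofReal_norm, Complex.norm_real, Real.norm_of_nonneg (by positivity),
          ENNReal.ofReal_rpow_of_nonneg (by positivity) hρ.le, ← Real.rpow_mul hd.le, hs]
        congr 1
        rw [← Real.rpow_neg_one]; congr 1; field_simp
      · simp only [bmp, indicator_of_notMem h]; simp [hρ]
    simp_rw [this]
    refine (setLIntegral_le_lintegral _ _).trans ?_
    rw [lintegral_indicator measurableSet_Ioc, setLIntegral_const, Real.volume_Ioc, ← ENNReal.ofReal_mul (by positivity)]
    rw [show (dd j)⁻¹ * (2 * dd j - dd j) = 1 by field_simp; norm_num]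
    simp
  calc _ ≤ ∫⁻ φ in Ioc (0:ℝ) (2*π), ∑ j : Fin N, ‖bmp s (dd j) φ‖ₑ ^ ρ := lintegral_mono h1
    _ = ∑ j : Fin N, ∫⁻ φ in Ioc (0:ℝ) (2*π), ‖bmp s (dd j) φ‖ₑ ^ ρ := by
        apply lintegral_finset_sum
        intro j _
        exact ((bmp_meas s (dd j)).enorm).pow_const ρ
    _ ≤ ∑ j : Fin N, 1 := Finset.sum_le_sum fun j _ => h2 j
    _ = N := by simp

lemma lower (γ s q : ℝ) (hγ : 0 < γ) (hq : 0 < q) (hs : γ + 1 - s = 2 / q) (N : ℕ) :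
    (Fintype.card (Fin N → ℤˣ) : ℝ≥0∞) * (N * ENNReal.ofReal ((1/(4*π))^q / 64)) ≤
    2 * ∑ ε : Fin N → ℤˣ, ∫⁻ p : ℝ × ℝ, ‖Rgamma γ (fun φ => ∑ j : Fin N, sg ε j * bmp s (dd j) φ) p.1 p.2‖ₑ ^ q := by
  set K : ℝ≥0∞ := (Fintype.card (Fin N → ℤˣ) : ℝ≥0∞) with hK
  set G : (ℝ × ℝ) → ℝ≥0∞ := fun p => 2 * ∑ ε : Fin N → ℤˣ, ‖Rgamma γ (fun φ => ∑ j : Fin N, sg ε j * bmp s (dd j) φ) p.1 p.2‖ₑ ^ q with hG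
  have hm : ∀ ε : Fin N → ℤˣ, Measurable (fun p : ℝ × ℝ => ‖Rgamma γ (fun φ => ∑ j : Fin N, sg ε j * bmp s (dd j) φ) p.1 p.2‖ₑ ^ q) := by
    intro ε
    refine ((Rgamma_meas γ _ ?_).enorm).pow_const q
    exact Finset.measurable_fun_sum _ fun j _ => (bmp_meas s (dd j)).const_mul _
  have e1 : 2 * ∑ ε : Fin N → ℤˣ, ∫⁻ p : ℝ × ℝ, ‖Rgamma γ (fun φ => ∑ j : Fin N, sg ε j * bmp s (dd j) φ) p.1 p.2‖ₑ ^ q = ∫⁻ p, G p := by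
    rw [← lintegral_finset_sum _ (fun ε _ => hm ε), ← lintegral_const_mul]
    exact Finset.measurable_fun_sum _ fun ε _ => hm ε
  rw [e1]
  have hdis : Pairwise (Function.onFun Disjoint (fun j : Fin N => reg (dd j))) := by
    intro i j hij
    rcases lt_or_gt_of_ne hij with h | h
    · exact reg_disj h
    · exact (reg_disj h).symm
  have hj : ∀ j : Fin N, K * ENNReal.ofReal ((1/(4*π))^q / 64) ≤ ∫⁻ p in reg (dd j), G p := by
    intro j
    have hd := dd_pos j
    have hpt : ∀ p ∈ reg (dd j), K * ENNReal.ofReal ((1/(4*π))^q * (dd j)^(2:ℝ)) ≤ G p := by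
      intro p hp
      have h1 := signs (fun i : Fin N => Rgamma γ (bmp s (dd i)) p.1 p.2) q hq j
      have h2 := bmp_lb γ s q (dd j) hγ hq hd (dd_le j) hs p hp
      simp only [hG, Rgamma_lin γ s (fun j : Fin N => dd j)]
      refine le_trans ?_ h1
      gcongr
      rw [← ofReal_norm, ENNReal.ofReal_rpow_of_nonneg (norm_nonneg _) hq.le]
      apply ENNReal.ofReal_le_ofReal
      calc _ = ((1 / (4*π)) * dd j ^ (2/q)) ^ q := by
            rw [Real.mul_rpow (by positivity) (by positivity), ← Real.rpow_mul hd.le]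
            congr 2; field_simp
        _ ≤ _ := by gcongr
    calc K * ENNReal.ofReal ((1/(4*π))^q / 64)
        = K * ENNReal.ofReal ((1/(4*π))^q * (dd j)^(2:ℝ)) * volume (reg (dd j)) := by
          rw [reg_vol _ hd, mul_assoc, ← ENNReal.ofReal_mul (by positivity)]
          congr 2
          rw [Real.rpow_neg hd.le]; field_simp
      _ = ∫⁻ p in reg (dd j), K * ENNReal.ofReal ((1/(4*π))^q * (dd j)^(2:ℝ)) := by
          rw [setLIntegral_const]
      _ ≤ _ := setLIntegral_mono' (reg_meas _) hpt
  calc K * (N * ENNReal.ofReal ((1/(4*π))^q / 64)) = ∑ j : Fin N, K * ENNReal.ofReal ((1/(4*π))^q / 64) := by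
        simp; ring
    _ ≤ ∑ j : Fin N, ∫⁻ p in reg (dd j), G p := Finset.sum_le_sum fun j _ => hj j
    _ = ∫⁻ p in ⋃ j : Fin N, reg (dd j), G p := by
        rw [lintegral_iUnion (fun j => reg_meas _) hdis, tsum_fintype]
    _ ≤ _ := setLIntegral_le_lintegral _ _

lemma core (γ s q ρ C : ℝ) (hγ : 0 < γ) (hq : 0 < q) (hs : γ + 1 - s = 2 / q) (hρ : 0 < ρ)
    (hsρ : s = 1/ρ) (hC : 0 < C)
    (hb : ∀ F : ℝ → ℂ, Measurable F →
      planeLp (ENNReal.ofReal q) (fun p => Rgamma γ F p.1 p.2) ≤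
        ENNReal.ofReal C * circleLp (ENNReal.ofReal ρ) F) (N : ℕ) :
    (N:ℝ) * ((1/(4*π))^q / 64) ≤ 2 * (C^q * (N:ℝ)^(q/ρ)) := by
  have hl := lower γ s q hγ hq hs N
  have hu : ∀ ε : Fin N → ℤˣ, ∫⁻ p : ℝ × ℝ, ‖Rgamma γ (fun φ => ∑ j : Fin N, sg ε j * bmp s (dd j) φ) p.1 p.2‖ₑ ^ q ≤ ENNReal.ofReal (C^q * (N:ℝ)^(q/ρ)) := by
    intro ε
    have h := hb (fun φ => ∑ j : Fin N, sg ε j * bmp s (dd j) φ)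
      (Finset.measurable_fun_sum _ fun j _ => (bmp_meas s (dd j)).const_mul _)
    unfold planeLp circleLp at h
    rw [eLpNorm_eq_lintegral_rpow_enorm_toReal (by simpa using hq) (by simp),
      eLpNorm_eq_lintegral_rpow_enorm_toReal (by simpa using hρ) (by simp),
      ENNReal.toReal_ofReal hq.le, ENNReal.toReal_ofReal hρ.le] at h
    have h' := ENNReal.rpow_le_rpow h hq.le
    rw [← ENNReal.rpow_mul, one_div_mul_cancel hq.ne', ENNReal.rpow_one] at h'
    refine h'.trans ?_
    rw [ENNReal.mul_rpow_of_nonneg _ _ hq.le, ← ENNReal.rpow_mul, ENNReal.ofReal_mul (by positivity),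
      ← ENNReal.ofReal_rpow_of_nonneg hC.le hq.le, ← ENNReal.ofReal_rpow_of_nonneg (by positivity) (by positivity),
      ENNReal.ofReal_natCast, show 1/ρ*q = q/ρ by ring]
    gcongr
    exact upper s ρ hρ hsρ N ε
  have h3 : (Fintype.card (Fin N → ℤˣ) : ℝ≥0∞) * (N * ENNReal.ofReal ((1/(4*π))^q / 64)) ≤
      (Fintype.card (Fin N → ℤˣ) : ℝ≥0∞) * (2 * ENNReal.ofReal (C^q * (N:ℝ)^(q/ρ))) := by
    refine hl.trans ?_
    calc _ ≤ 2 * ∑ ε : Fin N → ℤˣ, ENNReal.ofReal (C^q * (N:ℝ)^(q/ρ)) := by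
          gcongr with ε; exact hu ε
      _ = _ := by
          rw [Finset.sum_const, nsmul_eq_mul, Finset.card_univ]; ring
  have h4 := (ENNReal.mul_le_mul_iff_right (by simp [Fintype.card_ne_zero]) (ENNReal.natCast_ne_top _)).1 h3
  rw [← ENNReal.ofReal_natCast, ← ENNReal.ofReal_mul (by positivity), show (2:ℝ≥0∞) = ENNReal.ofReal 2 by simp,
    ← ENNReal.ofReal_mul (by positivity)] at h4
  exact (ENNReal.ofReal_le_ofReal_iff (by positivity)).1 h4

/-- Lemma 21: necessity of `q ≥ r` (read as `1/q ≤ 1/r`) for the endpoint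
estimate for `R*_γ`. -/
theorem statement17 (γ : ℝ) (hγ : 0 < γ)
    (r : ℝ≥0∞) (hr : 1 < r) (q : ℝ) (hq : 0 < q)
    (h1 : γ = max (3 / (2 * q) - (1 - r⁻¹.toReal) / 2) (2 / q - (1 - r⁻¹.toReal)))
    (h2 : γ > 2 / q - 1 / 2)
    (hbdd : ∃ C : ℝ, 0 < C ∧ ∀ F : ℝ → ℂ, Measurable F →
      planeLp (ENNReal.ofReal q) (fun p => Rgamma γ F p.1 p.2) ≤
        ENNReal.ofReal C * circleLp r F) :
    1 / q ≤ r⁻¹.toReal := by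
  rcases eq_or_ne r ⊤ with hrt | hrt
  · exfalso
    subst hrt
    simp only [ENNReal.inv_top, ENNReal.toReal_zero] at h1
    have hq' : 0 < 1 / q := by positivity
    have e1 : 3 / (2 * q) = 3/2 * (1/q) := by field_simp
    have e2 : 2 / q = 2 * (1/q) := by field_simp
    rw [e1, e2] at h1
    rw [e2] at h2
    rcases max_choice (3/2 * (1/q) - (1 - 0) / 2) (2 * (1/q) - (1 - 0)) with h | h <;>
      rw [h] at h1 <;> linarith
  set s := r⁻¹.toReal with hs
  have hr0 : r ≠ 0 := (zero_lt_one.trans hr).ne'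
  have hρ : 0 < r.toReal := ENNReal.toReal_pos hr0 hrt
  have hsρ : s = 1 / r.toReal := by rw [hs, ENNReal.toReal_inv, one_div]
  have hrρ : r = ENNReal.ofReal r.toReal := (ENNReal.ofReal_toReal hrt).symm
  by_contra hcon
  push Not at hcon
  have e1 : 3 / (2 * q) = 3/2 * (1/q) := by field_simp
  have e2 : 2 / q = 2 * (1/q) := by field_simp
  have hγ2 : γ + 1 - s = 2 / q := by
    rcases max_choice (3 / (2 * q) - (1 - s) / 2) (2 / q - (1 - s)) with h | h
    · rw [h, e1] at h1
      rw [e2] at h2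
      linarith
    · rw [h] at h1; linarith
  obtain ⟨C, hC, hb⟩ := hbdd
  rw [hrρ] at hb
  have hcore := core γ s q r.toReal C hγ hq hγ2 hρ hsρ hC hb
  have hlt : q / r.toReal < 1 := by
    rw [hsρ, div_lt_div_iff₀ hρ hq] at hcon
    rw [div_lt_one hρ]; linarith
  have hten : Tendsto (fun N : ℕ => (N:ℝ) ^ (1 - q / r.toReal)) atTop atTop :=
    (tendsto_rpow_atTop (by linarith)).comp tendsto_natCast_atTop_atTop
  have hc : 0 < (1/(4*π))^q / 64 := by positivity
  obtain ⟨N, hN1, hN⟩ := ((hten.eventually_gt_atTop (2 * C^q / ((1/(4*π))^q / 64))).and (eventually_ge_atTop 1)).exists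
  have hNp : (0:ℝ) < N := by exact_mod_cast hN
  have h := hcore N
  rw [div_lt_iff₀ hc] at hN1
  have hx : (0:ℝ) < (N:ℝ) ^ (q / r.toReal) := by positivity
  have hsplit : (N:ℝ) = (N:ℝ) ^ (1 - q / r.toReal) * (N:ℝ) ^ (q / r.toReal) := by
    rw [← Real.rpow_add hNp]; simp
  have h5 := mul_lt_mul_of_pos_right hN1 hx
  have h6 : (N:ℝ) ^ (1 - q / r.toReal) * ((1/(4*π))^q / 64) * (N:ℝ) ^ (q / r.toReal) = N * ((1/(4*π))^q / 64) := by
    conv_rhs => rw [hsplit]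
    ring
  rw [h6] at h5
  linarith
end
end

section
/- Let 0 < κ < 1 and σ > 0 with κ + σ > 1, let χ_∞ > 0, C₀ ≥ 0, and let χ : [0,∞) → ℝ be measurable with |χ(z) − χ_∞| ≤ C₀(1+z)^{−σ} for all z ≥ 0. Then: (a) the improper integral I(κ) := lim_{T→∞} ∫_0^T ρ^{−κ} cos(ρ) dρ exists and satisfies 0 < I(κ) < ∞; (b) for each λ > 0 the improper integral J(λ) := lim_{T→∞} ∫_0^T χ(r) r^{−κ} cos(λ r) dr exists, and lim_{λ→0⁺} λ^{1−κ} J(λ) = χ_∞ · I(κ). In particular, there exist c > 0 and λ₀ > 0 such that J(λ) ≥ c · λ^{κ−1} for all 0 < λ < λ₀. -/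
open MeasureTheory Real Set Filter

lemma aux_int {κ b c : ℝ} (hκ1 : κ < 1) (hb : b < -1) (f : ℝ → ℝ) (hf : Measurable f) (c' : ℝ)
    (h1 : ∀ x, 0 < x → |f x| ≤ c * x ^ (-κ)) (h2 : ∀ x, 0 < x → |f x| ≤ c' * x ^ b) :
    IntegrableOn f (Ioi 0) := by
  rw [← Ioc_union_Ioi_eq_Ioi (zero_le_one' ℝ)]
  apply IntegrableOn.union
  · have h : IntegrableOn (fun x : ℝ => c * x ^ (-κ)) (Ioc 0 1) := by
      have := (intervalIntegral.intervalIntegrable_rpow' (a := 0) (b := 1) (r := -κ) (by linarith)).const_mul c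
      exact (intervalIntegrable_iff_integrableOn_Ioc_of_le zero_le_one).1 this
    refine Integrable.mono' h hf.aestronglyMeasurable ?_
    filter_upwards [ae_restrict_mem measurableSet_Ioc] with x hx
    exact h1 x hx.1
  · have h : IntegrableOn (fun x : ℝ => c' * x ^ b) (Ioi 1) :=
      (integrableOn_Ioi_rpow_of_lt hb one_pos).const_mul c'
    refine Integrable.mono' h hf.aestronglyMeasurable ?_
    filter_upwards [ae_restrict_mem measurableSet_Ioi] with x hx
    exact h2 x (one_pos.trans hx)

lemma g_int {κ : ℝ} (hκ0 : 0 < κ) (hκ1 : κ < 1) :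
    IntegrableOn (fun x : ℝ => x ^ (-κ - 2) * (1 - Real.cos x)) (Ioi 0) := by
  refine aux_int (κ := κ) (b := -κ - 2) (c := 1) hκ1 (by linarith) _ (by fun_prop) 2 ?_ ?_
  · intro x hx
    have hc := Real.cos_le_one x
    have h := Real.one_sub_sq_div_two_le_cos (x := x)
    have hp : 0 < x ^ (-κ - 2) := rpow_pos_of_pos hx _
    rw [abs_of_nonneg (mul_nonneg hp.le (by linarith))]
    have : x ^ (-κ) = x ^ (-κ - 2) * x ^ 2 := by
      rw [← rpow_natCast x 2, ← rpow_add hx]; norm_num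
    rw [this]
    nlinarith [mul_le_mul_of_nonneg_left (show 1 - Real.cos x ≤ x ^ 2 by nlinarith [sq_nonneg x]) hp.le]
  · intro x hx
    have hc := Real.cos_le_one x
    have h := Real.neg_one_le_cos x
    have hp : 0 < x ^ (-κ - 2) := rpow_pos_of_pos hx _
    rw [abs_of_nonneg (mul_nonneg hp.le (by linarith))]
    nlinarith

lemma g_pos {κ : ℝ} (hκ0 : 0 < κ) (hκ1 : κ < 1) :
    0 < ∫ x in Ioi (0:ℝ), x ^ (-κ - 2) * (1 - Real.cos x) := by
  rw [setIntegral_pos_iff_support_of_nonneg_ae _ (g_int hκ0 hκ1)]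
  · have : Ioo (0:ℝ) 1 ⊆ (Function.support fun x : ℝ => x ^ (-κ - 2) * (1 - Real.cos x)) ∩ Ioi 0 := by
      intro x hx
      refine ⟨?_, hx.1⟩
      have hp : 0 < x ^ (-κ - 2) := rpow_pos_of_pos hx.1 _
      have : Real.cos x < 1 := by
        have := Real.cos_lt_cos_of_nonneg_of_le_pi (x := 0) (y := x) le_rfl
          (by linarith [hx.2, Real.pi_gt_three]) hx.1
        simpa using this
      exact (mul_pos hp (by linarith)).ne'
    refine lt_of_lt_of_le ?_ (measure_mono this)
    simp
  · filter_upwards [ae_restrict_mem measurableSet_Ioi] with x hx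
    exact mul_nonneg (rpow_nonneg (le_of_lt hx) _) (by linarith [Real.cos_le_one x])

lemma f_ii {κ : ℝ} (hκ1 : κ < 1) (l a b : ℝ) :
    IntervalIntegrable (fun x : ℝ => x ^ (-κ) * Real.cos (l * x)) volume a b :=
  (intervalIntegral.intervalIntegrable_rpow' (by linarith)).mul_continuousOn (by fun_prop)

lemma F_bound {κ : ℝ} (hκ0 : 0 < κ) (x : ℝ) (hx : 0 ≤ x) :
    |x ^ (-κ) * Real.sin x + κ * (x ^ (-κ - 1) * (1 - Real.cos x))| ≤ (1 + κ) * x ^ (1 - κ) := by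
  rcases hx.eq_or_lt with rfl | hx
  · simp; positivity
  have hc := Real.cos_le_one x
  have h := Real.one_sub_sq_div_two_le_cos (x := x)
  have hp : 0 < x ^ (-κ - 1) := rpow_pos_of_pos hx _
  have e1 : x ^ (-κ) = x ^ (-κ - 1) * x := by
    rw [← rpow_add_one hx.ne']; norm_num
  have e2 : x ^ (1 - κ) = x ^ (-κ - 1) * x ^ 2 := by
    rw [← rpow_natCast x 2, ← rpow_add hx]; norm_num; ring_nf
  have hs : |Real.sin x| ≤ x := by
    have := Real.abs_sin_le_abs (x := x)
    rwa [abs_of_pos hx] at this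
  rw [e1, e2]
  have : x ^ (-κ - 1) * x * Real.sin x + κ * (x ^ (-κ - 1) * (1 - Real.cos x))
    = x ^ (-κ - 1) * (x * Real.sin x + κ * (1 - Real.cos x)) := by ring
  rw [this, abs_mul, abs_of_pos hp]
  have : |x * Real.sin x + κ * (1 - Real.cos x)| ≤ (1 + κ) * x ^ 2 := by
    have h3 : |x * Real.sin x| ≤ x * x := by
      rw [abs_mul, abs_of_pos hx]; gcongr
    have h4 : |κ * (1 - Real.cos x)| ≤ κ * x ^ 2 := by
      rw [abs_of_nonneg (mul_nonneg hκ0.le (by linarith))]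
      gcongr; nlinarith [sq_nonneg x]
    calc _ ≤ _ := abs_add_le _ _
      _ ≤ x * x + κ * x ^ 2 := add_le_add h3 h4
      _ = _ := by ring
  calc _ ≤ x ^ (-κ - 1) * ((1 + κ) * x ^ 2) := by gcongr
    _ = _ := by ring

lemma F_deriv {κ x : ℝ} (hx : 0 < x) :
    HasDerivAt (fun x : ℝ => x ^ (-κ) * Real.sin x + κ * (x ^ (-κ - 1) * (1 - Real.cos x)))
      (x ^ (-κ) * Real.cos x - κ * (κ + 1) * (x ^ (-κ - 2) * (1 - Real.cos x))) x := by
  have h1 := (Real.hasDerivAt_rpow_const (x := x) (p := -κ) (Or.inl hx.ne')).mul (Real.hasDerivAt_sin x)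
  have h2 := (Real.hasDerivAt_rpow_const (x := x) (p := -κ - 1) (Or.inl hx.ne')).mul
    ((Real.hasDerivAt_cos x).const_sub 1)
  refine (h1.add (h2.const_mul κ)).congr_deriv ?_
  rw [show -κ - 1 - 1 = -κ - 2 by ring]
  ring

lemma F_cont {κ : ℝ} (hκ0 : 0 < κ) (hκ1 : κ < 1) (T : ℝ) :
    ContinuousOn (fun x : ℝ => x ^ (-κ) * Real.sin x + κ * (x ^ (-κ - 1) * (1 - Real.cos x)))
      (Icc 0 T) := by
  intro x hx
  rcases hx.1.eq_or_lt with rfl | h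
  · have hz : Tendsto (fun x : ℝ => (1 + κ) * x ^ (1 - κ)) (nhdsWithin 0 (Icc 0 T)) (nhds 0) := by
      have : ContinuousAt (fun x : ℝ => (1 + κ) * x ^ (1 - κ)) 0 :=
        continuousAt_const.mul (Real.continuousAt_rpow_const _ _ (Or.inr (by linarith)))
      have h := this.tendsto
      rw [zero_rpow (by linarith), mul_zero] at h
      exact h.mono_left nhdsWithin_le_nhds
    unfold ContinuousWithinAt
    simp only [Real.sin_zero, Real.cos_zero, sub_self, mul_zero, add_zero]
    refine squeeze_zero_norm' ?_ hz
    filter_upwards [self_mem_nhdsWithin] with y hy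
    exact F_bound hκ0 y hy.1
  · exact (F_deriv h).continuousAt.continuousWithinAt

lemma I_tendsto {κ : ℝ} (hκ0 : 0 < κ) (hκ1 : κ < 1) :
    Tendsto (fun T : ℝ => ∫ ρ in (0:ℝ)..T, ρ ^ (-κ) * Real.cos ρ) atTop
      (nhds (κ * (κ + 1) * ∫ x in Ioi (0:ℝ), x ^ (-κ - 2) * (1 - Real.cos x))) := by
  have hg := g_int hκ0 hκ1
  have key : ∀ T : ℝ, 0 ≤ T → (∫ ρ in (0:ℝ)..T, ρ ^ (-κ) * Real.cos ρ) =
      (T ^ (-κ) * Real.sin T + κ * (T ^ (-κ - 1) * (1 - Real.cos T)))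
      + κ * (κ + 1) * ∫ x in (0:ℝ)..T, x ^ (-κ - 2) * (1 - Real.cos x) := by
    intro T hT
    have i1 : IntervalIntegrable (fun x : ℝ => x ^ (-κ) * Real.cos x) volume 0 T := by
      simpa using f_ii hκ1 1 0 T
    have i2 : IntervalIntegrable (fun x : ℝ => κ * (κ + 1) * (x ^ (-κ - 2) * (1 - Real.cos x))) volume 0 T :=
      ((intervalIntegrable_iff_integrableOn_Ioc_of_le hT).2
        (hg.mono_set Ioc_subset_Ioi_self)).const_mul _
    have := intervalIntegral.integral_eq_sub_of_hasDerivAt_of_le hT (F_cont hκ0 hκ1 T)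
      (fun x hx => F_deriv hx.1) (i1.sub i2)
    rw [intervalIntegral.integral_sub i1 i2, intervalIntegral.integral_const_mul] at this
    simp only [Real.sin_zero, Real.cos_zero, sub_self, mul_zero, add_zero, sub_zero] at this
    linarith
  have hF : Tendsto (fun T : ℝ => T ^ (-κ) * Real.sin T + κ * (T ^ (-κ - 1) * (1 - Real.cos T)))
      atTop (nhds 0) := by
    have t1 := tendsto_rpow_neg_atTop hκ0
    have t2 := tendsto_rpow_neg_atTop (show 0 < κ + 1 by linarith)
    have t : Tendsto (fun T : ℝ => T ^ (-κ) + κ * (T ^ (-(κ+1)) * 2)) atTop (nhds 0) := by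
      simpa using t1.add ((t2.mul_const 2).const_mul κ)
    refine squeeze_zero_norm' ?_ t
    filter_upwards [eventually_gt_atTop 0] with T hT
    have p1 : 0 < T ^ (-κ) := rpow_pos_of_pos hT _
    have p2 : 0 < T ^ (-(κ+1)) := rpow_pos_of_pos hT _
    rw [show -κ - 1 = -(κ+1) by ring, Real.norm_eq_abs]
    refine (abs_add_le _ _).trans (add_le_add ?_ ?_)
    · rw [abs_mul, abs_of_pos p1]
      exact mul_le_of_le_one_right p1.le (Real.abs_sin_le_one _)
    · have := Real.neg_one_le_cos T
      have := Real.cos_le_one T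
      rw [abs_of_nonneg (mul_nonneg hκ0.le (mul_nonneg p2.le (by linarith)))]
      gcongr; linarith
  have hG := intervalIntegral_tendsto_integral_Ioi 0 hg tendsto_id
  have := hF.add (hG.const_mul (κ * (κ + 1)))
  rw [zero_add] at this
  refine this.congr' ?_
  filter_upwards [eventually_ge_atTop 0] with T hT
  exact (key T hT).symm

lemma scale {κ l : ℝ} (hl : 0 < l) (T : ℝ) (hT : 0 ≤ T) :
    ∫ r in (0:ℝ)..T, r ^ (-κ) * Real.cos (l * r)
      = l ^ (κ - 1) * ∫ ρ in (0:ℝ)..(l * T), ρ ^ (-κ) * Real.cos ρ := by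
  have h := intervalIntegral.integral_comp_mul_left (a := 0) (b := T)
    (fun ρ : ℝ => ρ ^ (-κ) * Real.cos ρ) hl.ne'
  rw [mul_zero] at h
  have h2 : ∫ r in (0:ℝ)..T, r ^ (-κ) * Real.cos (l * r)
      = ∫ r in (0:ℝ)..T, l ^ κ * ((l * r) ^ (-κ) * Real.cos (l * r)) := by
    refine intervalIntegral.integral_congr fun r hr => ?_
    rw [uIcc_of_le hT] at hr
    have : l ^ κ * l ^ (-κ) = 1 := by rw [← rpow_add hl]; simp
    rw [mul_rpow hl.le hr.1]
    linear_combination (-(r ^ (-κ) * Real.cos (l * r))) * this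
  rw [h2, intervalIntegral.integral_const_mul, h, smul_eq_mul, rpow_sub_one hl.ne']
  ring

theorem statement18 (κ σ χinf C₀ : ℝ) (χ : ℝ → ℝ)
    (hκ0 : 0 < κ) (hκ1 : κ < 1) (hσ : 0 < σ) (hκσ : 1 < κ + σ)
    (hχinf : 0 < χinf) (hC₀ : 0 ≤ C₀) (hχm : Measurable χ)
    (hχ : ∀ z : ℝ, 0 ≤ z → |χ z - χinf| ≤ C₀ * (1 + z) ^ (-σ)) :
    ∃ I : ℝ,
      Tendsto (fun T : ℝ => ∫ ρ in (0:ℝ)..T, ρ ^ (-κ) * Real.cos ρ) atTop (nhds I) ∧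
      0 < I ∧
      ∃ J : ℝ → ℝ,
        (∀ l : ℝ, 0 < l →
          Tendsto (fun T : ℝ => ∫ r in (0:ℝ)..T, χ r * r ^ (-κ) * Real.cos (l * r))
            atTop (nhds (J l))) ∧
        Tendsto (fun l : ℝ => l ^ (1 - κ) * J l) (nhdsWithin 0 (Ioi 0))
          (nhds (χinf * I)) ∧
        ∃ c : ℝ, 0 < c ∧ ∃ l₀ : ℝ, 0 < l₀ ∧
          ∀ l : ℝ, 0 < l → l < l₀ → c * l ^ (κ - 1) ≤ J l := by
  have hI := I_tendsto hκ0 hκ1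
  have hIpos : 0 < κ * (κ + 1) * ∫ x in Ioi (0:ℝ), x ^ (-κ - 2) * (1 - Real.cos x) :=
    mul_pos (by positivity) (g_pos hκ0 hκ1)
  generalize (κ * (κ + 1) * ∫ x in Ioi (0:ℝ), x ^ (-κ - 2) * (1 - Real.cos x)) = I at hI hIpos
  refine ⟨I, hI, hIpos, ?_⟩
  have b1 : ∀ x : ℝ, 0 < x → |(χ x - χinf) * x ^ (-κ)| ≤ C₀ * x ^ (-κ) := by
    intro x hx
    have p1 : 0 < x ^ (-κ) := rpow_pos_of_pos hx _
    rw [abs_mul, abs_of_pos p1]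
    gcongr
    refine (hχ x hx.le).trans (mul_le_of_le_one_right hC₀ ?_)
    exact rpow_le_one_of_one_le_of_nonpos (by linarith) (by linarith)
  have b2 : ∀ x : ℝ, 0 < x → |(χ x - χinf) * x ^ (-κ)| ≤ C₀ * x ^ (-σ - κ) := by
    intro x hx
    have p1 : 0 < x ^ (-κ) := rpow_pos_of_pos hx _
    rw [abs_mul, abs_of_pos p1, sub_eq_add_neg (-σ), rpow_add hx, ← mul_assoc]
    gcongr
    refine (hχ x hx.le).trans (mul_le_mul_of_nonneg_left ?_ hC₀)
    exact rpow_le_rpow_of_nonpos hx (by linarith) (by linarith)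
  have hh : IntegrableOn (fun x : ℝ => (χ x - χinf) * x ^ (-κ)) (Ioi 0) :=
    aux_int hκ1 (by linarith) _ (by fun_prop) C₀ b1 b2
  have hE : ∀ l : ℝ, IntegrableOn (fun x : ℝ => (χ x - χinf) * x ^ (-κ) * Real.cos (l * x)) (Ioi 0) := by
    intro l
    refine Integrable.mono hh (by fun_prop) (Eventually.of_forall fun x => ?_)
    rw [norm_mul]
    exact mul_le_of_le_one_right (norm_nonneg _) (Real.abs_cos_le_one _)
  set E : ℝ → ℝ := fun l => ∫ x in Ioi (0:ℝ), (χ x - χinf) * x ^ (-κ) * Real.cos (l * x) with hEdef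
  have hEb : ∀ l, |E l| ≤ ∫ x in Ioi (0:ℝ), ‖(χ x - χinf) * x ^ (-κ)‖ := by
    intro l
    rw [← Real.norm_eq_abs]
    refine norm_integral_le_of_norm_le hh.norm (Eventually.of_forall fun x => ?_)
    rw [norm_mul]
    exact mul_le_of_le_one_right (norm_nonneg _) (Real.abs_cos_le_one _)
  have hlim : Tendsto (fun l : ℝ => l ^ (1 - κ) * (χinf * (l ^ (κ - 1) * I) + E l))
      (nhdsWithin 0 (Ioi 0)) (nhds (χinf * I)) := by
    have hz : Tendsto (fun l : ℝ => l ^ (1 - κ)) (nhdsWithin 0 (Ioi 0)) (nhds 0) := by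
      have h := (Real.continuousAt_rpow_const (0:ℝ) (1 - κ) (Or.inr (by linarith))).tendsto
      rw [zero_rpow (by linarith)] at h
      exact h.mono_left nhdsWithin_le_nhds
    have hz2 : Tendsto (fun l : ℝ => l ^ (1 - κ) * E l) (nhdsWithin 0 (Ioi 0)) (nhds 0) := by
      have hz3 := hz.mul_const (∫ x in Ioi (0:ℝ), ‖(χ x - χinf) * x ^ (-κ)‖)
      rw [zero_mul] at hz3
      refine squeeze_zero_norm' ?_ hz3
      filter_upwards [self_mem_nhdsWithin] with l hl
      have p : 0 < l ^ (1 - κ) := rpow_pos_of_pos hl _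
      rw [norm_mul, Real.norm_eq_abs, abs_of_pos p]
      exact mul_le_mul_of_nonneg_left (hEb l) p.le
    have := hz2.const_add (χinf * I)
    rw [add_zero] at this
    refine this.congr' ?_
    filter_upwards [self_mem_nhdsWithin] with l hl
    have : l ^ (1 - κ) * l ^ (κ - 1) = 1 := by rw [← rpow_add hl]; simp
    linear_combination (-(χinf * I)) * this
  refine ⟨fun l => χinf * (l ^ (κ - 1) * I) + E l, ?_, hlim, ?_⟩
  · intro l hl
    have t1 := ((hI.comp (tendsto_id.const_mul_atTop hl)).const_mul (l ^ (κ - 1))).const_mul χinf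
    have t2 := intervalIntegral_tendsto_integral_Ioi 0 (hE l) tendsto_id
    refine (t1.add t2).congr' ?_
    filter_upwards [eventually_ge_atTop 0] with T hT
    simp only [Function.comp, id]
    rw [← scale hl T hT, ← intervalIntegral.integral_const_mul,
      ← intervalIntegral.integral_add ((f_ii hκ1 l 0 T).const_mul χinf)
        ((intervalIntegrable_iff_integrableOn_Ioc_of_le hT).2
          ((hE l).mono_set Ioc_subset_Ioi_self))]
    congr 1; ext r; ring
  · refine ⟨χinf * I / 2, by positivity, ?_⟩
    have hpos : 0 < χinf * I := by positivity
    have ev := hlim.eventually (lt_mem_nhds (show χinf * I / 2 < χinf * I by linarith))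
    obtain ⟨l₀, hl₀, hsub⟩ := mem_nhdsGT_iff_exists_Ioo_subset.1 ev
    refine ⟨l₀, hl₀, fun l hl hl' => ?_⟩
    have h := hsub ⟨hl, hl'⟩
    simp only [mem_ofPred_eq] at h
    have e : l ^ (κ - 1) * l ^ (1 - κ) = 1 := by rw [← rpow_add hl]; simp
    have p : 0 < l ^ (κ - 1) := rpow_pos_of_pos hl _
    have := mul_le_mul_of_nonneg_left h.le p.le
    rw [← mul_assoc, e, one_mul] at this
    linarith
end

section
/- Let α, β ∈ ℝ with 0 ≤ β ≤ α, let 1 ≤ r < ∞ and 0 < q < ∞ with α < 1/q. Then the following are equivalent. (A) There exist real numbers r₀ ∈ [1,∞], r₁ ∈ [1,∞), q₀ ∈ [1,∞], q₁ ∈ (0,∞] and θ ∈ (0,1) such that 1/q = (1−θ)/q₀ + θ/q₁, 1/r = (1−θ)/r₀ + θ/r₁, 1/q₀ ≤ 1/(3r₀′), 1/q₀ < 1/4, α/θ = 1/q₁, β/θ ≥ 1/q₁ − 1/(2r₁′), and q₀ ≠ q₁. (B) α + β > 2/q − 1/2 and α + 2β ≥ 3/q − 1/r′. -/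
open scoped ENNReal

/-- Proposition 23 (interpolation arithmetic).  Exponents `r₀ ∈ [1,∞]`,
`r₁ ∈ [1,∞)`, `q₀ ∈ [1,∞]`, `q₁ ∈ (0,∞]` are modelled as elements of `ℝ≥0∞`,
with `1/p` interpreted as `(p⁻¹).toReal` (so `1/∞ = 0`) and
`1/p' = 1 - 1/p`. -/
theorem statement19 (α β r q : ℝ) (hβ0 : 0 ≤ β) (hβα : β ≤ α)
    (hr : 1 ≤ r) (hq : 0 < q) (hα : α < 1 / q) :
    (∃ (r₀ r₁ q₀ q₁ : ℝ≥0∞) (θ : ℝ),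
      1 ≤ r₀ ∧ 1 ≤ r₁ ∧ r₁ ≠ ⊤ ∧ 1 ≤ q₀ ∧ 0 < q₁ ∧ 0 < θ ∧ θ < 1 ∧
      1 / q = (1 - θ) * q₀⁻¹.toReal + θ * q₁⁻¹.toReal ∧
      1 / r = (1 - θ) * r₀⁻¹.toReal + θ * r₁⁻¹.toReal ∧
      q₀⁻¹.toReal ≤ (1 - r₀⁻¹.toReal) / 3 ∧
      q₀⁻¹.toReal < 1 / 4 ∧
      α / θ = q₁⁻¹.toReal ∧
      β / θ ≥ q₁⁻¹.toReal - (1 - r₁⁻¹.toReal) / 2 ∧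
      q₀ ≠ q₁)
    ↔ (α + β > 2 / q - 1 / 2 ∧ α + 2 * β ≥ 3 / q - (1 - 1 / r)) := by
  have hQ : 0 < 1 / q := by positivity
  have hR0 : 0 < 1 / r := by positivity
  have e2 : 2 / q = 2 * (1 / q) := by ring
  have e3 : 3 / q = 3 * (1 / q) := by ring
  rw [e2, e3]
  generalize 1 / q = Q at *
  generalize 1 / r = R at *
  constructor
  · rintro ⟨r₀, r₁, q₀, q₁, θ, hr0, hr1, hr1t, hq0, hq1, hθ0, hθ1, hQe, hRe, h1, h2, h3, h4, -⟩
    have hb1 : 0 < r₁⁻¹.toReal :=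
      ENNReal.toReal_pos (ENNReal.inv_ne_zero.2 hr1t)
        (ENNReal.inv_ne_top.2 (zero_lt_one.trans_le hr1).ne')
    rw [← h3] at hQe h4
    have k : θ * (α / θ) = α := by field_simp
    have k' : θ * (β / θ) = β := by field_simp
    rw [k] at hQe
    have h4' := mul_le_mul_of_nonneg_left h4 hθ0.le
    rw [k', mul_sub, k] at h4'
    have h1' := mul_le_mul_of_nonneg_left h1 (sub_pos.2 hθ1).le
    have h2' := mul_lt_mul_of_pos_left h2 (sub_pos.2 hθ1)
    have h5 := mul_pos hθ0 hb1
    constructor <;> nlinarith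
  · rintro ⟨hA, hB⟩
    have hlt : 2 * (α - β) < 1 - 4 * (Q - α) := by linarith
    obtain ⟨θ, hl, hu, hne⟩ : ∃ θ, 2 * (α - β) < θ ∧ θ < 1 - 4 * (Q - α) ∧ θ ≠ α / Q := by
      obtain ⟨a, ha, ha'⟩ := exists_between hlt
      obtain ⟨b, hb, hb'⟩ := exists_between ha'
      by_cases h : a = α / Q
      · exact ⟨b, by linarith, hb', fun h' => by linarith⟩
      · exact ⟨a, ha, ha', h⟩
    have hθ0 : 0 < θ := by linarith
    have hθ1 : θ < 1 := by linarith
    have hθ2 : 0 < 1 - θ := by linarith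
    obtain ⟨x, y, hx, hx', hy, hy', hxy⟩ : ∃ x y, 0 ≤ x ∧ x ≤ 1 - θ - 3 * (Q - α) ∧ 0 < y ∧
        y ≤ θ - 2 * (α - β) ∧ R = x + y := by
      by_cases h : R ≤ θ - 2 * (α - β)
      · exact ⟨0, R, le_rfl, by linarith, hR0, h, by ring⟩
      · exact ⟨R - (θ - 2 * (α - β)), θ - 2 * (α - β), by linarith, by linarith, by linarith,
          le_rfl, by ring⟩
    have key : ∀ a : ℝ, 0 ≤ a → ((ENNReal.ofReal a)⁻¹)⁻¹.toReal = a := fun a ha => by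
      rw [inv_inv, ENNReal.toReal_ofReal ha]
    have key1 : ∀ a : ℝ, a ≤ 1 → 1 ≤ (ENNReal.ofReal a)⁻¹ := fun a ha => by
      rw [ENNReal.one_le_inv]; exact ENNReal.ofReal_le_one.2 ha
    have pa0 : 0 ≤ (Q - α) / (1 - θ) := div_nonneg (by linarith) hθ2.le
    have pa1 : 0 ≤ α / θ := div_nonneg (by linarith) hθ0.le
    have pb0 : 0 ≤ x / (1 - θ) := div_nonneg hx hθ2.le
    have pb1 : 0 < y / θ := div_pos hy hθ0
    have lt4 : (Q - α) / (1 - θ) < 1 / 4 := by rw [div_lt_iff₀ hθ2]; linarith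
    refine ⟨(ENNReal.ofReal (x / (1 - θ)))⁻¹, (ENNReal.ofReal (y / θ))⁻¹,
      (ENNReal.ofReal ((Q - α) / (1 - θ)))⁻¹, (ENNReal.ofReal (α / θ))⁻¹, θ,
      key1 _ ?_, key1 _ ?_, ?_, key1 _ (by linarith), ?_, hθ0, hθ1, ?_⟩
    · rw [div_le_one hθ2]; linarith
    · rw [div_le_one hθ0]; linarith
    · exact ENNReal.inv_ne_top.2 (ENNReal.ofReal_pos.2 pb1).ne'
    · exact ENNReal.inv_pos.2 ENNReal.ofReal_ne_top
    rw [key _ pa0, key _ pa1, key _ pb0, key _ pb1.le]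
    refine ⟨?_, ?_, ?_, lt4, rfl, ?_, ?_⟩
    · field_simp; ring
    · rw [hxy]; field_simp
    · have : (1 - x / (1 - θ)) / 3 = ((1 - θ - x) / 3) / (1 - θ) := by field_simp
      rw [this]
      exact div_le_div_of_nonneg_right (by linarith) hθ2.le
    · have : α / θ - (1 - y / θ) / 2 = (α - (θ - y) / 2) / θ := by field_simp
      rw [this]
      exact div_le_div_of_nonneg_right (by linarith) hθ0.le
    · intro h
      have h' := (ENNReal.ofReal_eq_ofReal_iff pa0 pa1).1 (inv_injective h)
      rw [div_eq_div_iff hθ2.ne' hθ0.ne'] at h'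
      apply hne
      rw [eq_div_iff hQ.ne']
      linarith
end
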